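/- arXiv:2504.08079 — 2 statements merged into one kernel-verified Lean document; each statement's English description precedes it below -/
import Mathlib

section
/- Let p > 0, let K > 1 be an integer with K/ln(K) ≥ 2(p+1)L_f/μ_f, let γ ≤ 1/(2L_h), and run IR-ISTA with the constant regularization parameter η := (p+1)ln(K)/(γμ_f K). Then: 0 ≤ h̄(x̄_K) − h̄* ≤ u_4/K^{p+1} + u_5·ln(K)/K, where u_4 := ‖x_0 − x*‖²/(2γ) and u_5 := (p+1)(f̄* − Ĉ_f̄)/(γμ_f). -/
open scoped RealInnerProductSpace
open Metric Filter

noncomputable section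

section ProximalGradient

variable {E : Type*} [NormedAddCommGroup E] [InnerProductSpace ℝ E]

/-- Descent lemma for functions with Lipschitz gradient. -/
theorem descent_of_lipschitz_gradient [CompleteSpace E] {g : E → ℝ} {g' : E → E} {L : ℝ}
    (hg : ∀ x, HasGradientAt g (g' x) x) (hL : ∀ x y, ‖g' x - g' y‖ ≤ L * ‖x - y‖) (x y : E) :
    g y ≤ g x + ⟪g' x, y - x⟫ + L / 2 * ‖y - x‖ ^ 2 := by
  set d := y - x with hd
  let φ : ℝ → ℝ := fun t ↦ g (x + t • d) - t * ⟪g' x, d⟫ - L / 2 * t ^ 2 * ‖d‖ ^ 2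
  have hφ : ∀ t, HasDerivAt φ (⟪g' (x + t • d), d⟫ - ⟪g' x, d⟫ - L * t * ‖d‖ ^ 2) t := by
    intro t
    have hline : HasDerivAt (fun s : ℝ ↦ x + s • d) d t := by
      simpa using ((hasDerivAt_id t).smul_const d).const_add x
    have h1 : HasDerivAt (fun s : ℝ ↦ g (x + s • d)) ⟪g' (x + t • d), d⟫ t := by
      simpa [Function.comp_def] using
        ((hg (x + t • d)).hasFDerivAt).comp_hasDerivAt t hline
    have h2 := (hasDerivAt_id t).mul_const ⟪g' x, d⟫
    have h3 := (((hasDerivAt_id t).pow 2).const_mul (L / 2)).mul_const (‖d‖ ^ 2)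
    refine ((h1.sub h2).sub h3).congr_deriv ?_
    simp only [id_eq]
    push_cast
    ring
  have hanti : AntitoneOn φ (Set.Icc 0 1) := by
    apply antitoneOn_of_deriv_nonpos (convex_Icc 0 1)
      (fun t _ ↦ (hφ t).continuousAt.continuousWithinAt)
      (fun t _ ↦ (hφ t).differentiableAt.differentiableWithinAt)
    intro t ht
    rw [interior_Icc] at ht
    rw [(hφ t).deriv, ← inner_sub_left]
    have h1 := real_inner_le_norm (g' (x + t • d) - g' x) d
    have h2 := hL (x + t • d) x
    rw [add_sub_cancel_left, norm_smul, Real.norm_of_nonneg ht.1.le] at h2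
    nlinarith [mul_le_mul_of_nonneg_right h2 (norm_nonneg d)]
  have h01 := hanti (by simp) (by simp) (zero_le_one' ℝ)
  simp only [φ, hd, one_smul, zero_smul, add_sub_cancel, add_zero] at h01
  linarith

theorem add_le_of_forall_add_mul_le {a b c : ℝ}
    (h : ∀ t ∈ Set.Ioo (0 : ℝ) 1, a + (1 - t) * b ≤ c) : a + b ≤ c := by
  have hcont : ContinuousWithinAt (fun t : ℝ ↦ a + (1 - t) * b) (Set.Ioi 0) 0 := by fun_prop
  have hlim : Tendsto (fun t : ℝ ↦ a + (1 - t) * b) (nhdsWithin 0 (Set.Ioi 0)) (nhds (a + b)) := by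
    simpa [ContinuousWithinAt] using hcont
  exact le_of_tendsto hlim
    (Filter.mem_of_superset (Ioo_mem_nhdsGT one_pos) h)

/-- First-order lower bound for a strongly convex function. -/
theorem StrongConvexOn.add_inner_gradient_le [CompleteSpace E] {f : E → ℝ} {v x : E} {m : ℝ}
    (hf : StrongConvexOn Set.univ m f) (hv : HasGradientAt f v x) (u : E) :
    f x + ⟪v, u - x⟫ + m / 2 * ‖u - x‖ ^ 2 ≤ f u := by
  have hderiv : HasDerivAt (fun t : ℝ ↦ f (x + t • (u - x))) ⟪v, u - x⟫ 0 := by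
    have hline : HasDerivAt (fun s : ℝ ↦ x + s • (u - x)) (u - x) 0 := by
      simpa using ((hasDerivAt_id (0 : ℝ)).smul_const (u - x)).const_add x
    have hv' : HasGradientAt f v (x + (0 : ℝ) • (u - x)) := by simpa using hv
    simpa [Function.comp_def] using hv'.hasFDerivAt.comp_hasDerivAt 0 hline
  have hslope := hderiv.tendsto_slope_zero_right
  have hcont : ContinuousWithinAt (fun t : ℝ ↦ f u - f x - (1 - t) * (m / 2 * ‖u - x‖ ^ 2))
      (Set.Ioi 0) 0 := by fun_prop
  have hle := le_of_tendsto_of_tendsto hslope hcont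
    (Filter.mem_of_superset (Ioo_mem_nhdsGT one_pos) ?_)
  · simp only [sub_zero, one_mul] at hle
    linarith
  · intro t ht
    have hc := hf.2 (Set.mem_univ x) (Set.mem_univ u) (sub_nonneg.2 ht.2.le) ht.1.le
      (sub_add_cancel 1 t)
    have hpt : (1 - t) • x + t • u = x + t • (u - x) := by module
    rw [hpt, norm_sub_rev x u] at hc
    simp only [smul_eq_mul] at hc
    simp only [Set.mem_ofPred_eq, zero_add, zero_smul, add_zero, smul_eq_mul]
    rw [inv_mul_le_iff₀ ht.1]
    linarith

/-- Quadratic growth of a proximal objective around its minimizer. -/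
theorem ConvexOn.prox_add_sq_le {ω : E → ℝ} (hω : ConvexOn ℝ Set.univ ω) {c : ℝ} {z w : E}
    (hw : ∀ u, ω w + c * ‖w - z‖ ^ 2 ≤ ω u + c * ‖u - z‖ ^ 2) (u : E) :
    ω w + c * ‖w - z‖ ^ 2 + c * ‖u - w‖ ^ 2 ≤ ω u + c * ‖u - z‖ ^ 2 := by
  apply add_le_of_forall_add_mul_le
  intro t ht
  have hc := hω.2 (Set.mem_univ w) (Set.mem_univ u) (sub_nonneg.2 ht.2.le) ht.1.le
    (sub_add_cancel 1 t)
  have hm := hw ((1 - t) • w + t • u)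
  have hsplit : (1 - t) • w + t • u - z = (w - z) + t • (u - w) := by module
  have hu : u - z = (w - z) + (u - w) := by abel
  rw [hsplit, norm_add_sq_real, norm_smul, inner_smul_right, Real.norm_of_nonneg ht.1.le] at hm
  rw [hu, norm_add_sq_real]
  simp only [smul_eq_mul] at hc
  refine le_of_mul_le_mul_left ?_ ht.1
  linarith

/-- One step of the proximal gradient method on `g + ω`. -/
theorem proximal_gradient_step {g ω : E → ℝ} (hω : ConvexOn ℝ Set.univ ω) {γ m : ℝ}
    (hγ : 0 < γ) {G x w u : E}
    (hw : ∀ u, ω w + 1 / (2 * γ) * ‖w - (x - γ • G)‖ ^ 2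
      ≤ ω u + 1 / (2 * γ) * ‖u - (x - γ • G)‖ ^ 2)
    (hdesc : g w ≤ g x + ⟪G, w - x⟫ + 1 / (2 * γ) * ‖w - x‖ ^ 2)
    (hlow : g x + ⟪G, u - x⟫ + m / 2 * ‖u - x‖ ^ 2 ≤ g u) :
    2 * γ * ((g w + ω w) - (g u + ω u)) ≤ (1 - γ * m) * ‖x - u‖ ^ 2 - ‖w - u‖ ^ 2 := by
  have hp := hω.prox_add_sq_le hw u
  have hexp : ∀ v : E, 1 / (2 * γ) * ‖v - (x - γ • G)‖ ^ 2
      = 1 / (2 * γ) * ‖v - x‖ ^ 2 + ⟪G, v - x⟫ + γ / 2 * ‖G‖ ^ 2 := by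
    intro v
    have : v - (x - γ • G) = (v - x) + γ • G := by abel
    rw [this, norm_add_sq_real, norm_smul, inner_smul_right, Real.norm_of_nonneg hγ.le,
      real_inner_comm]
    field_simp
  rw [hexp w, hexp u] at hp
  rw [norm_sub_rev x u, norm_sub_rev w u]
  have hsum : (g w + ω w) - (g u + ω u)
      ≤ 1 / (2 * γ) * ‖u - x‖ ^ 2 - 1 / (2 * γ) * ‖u - w‖ ^ 2 - m / 2 * ‖u - x‖ ^ 2 := by
    linarith
  have hmul := mul_le_mul_of_nonneg_left hsum (by positivity : 0 ≤ 2 * γ)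
  have heq : 2 * γ * (1 / (2 * γ) * ‖u - x‖ ^ 2 - 1 / (2 * γ) * ‖u - w‖ ^ 2
      - m / 2 * ‖u - x‖ ^ 2) = (1 - γ * m) * ‖u - x‖ ^ 2 - ‖u - w‖ ^ 2 := by
    field_simp
    ring
  linarith

/-- Ergodic bound obtained by telescoping a contraction inequality with geometric weights. -/
theorem ConvexOn.geometric_average_le {F : E → ℝ} (hF : ConvexOn ℝ Set.univ F) {c r : ℝ}
    (hr : 0 < r) {x : ℕ → E} {u : E}
    (hstep : ∀ k, c * (F (x (k + 1)) - F u) ≤ r * ‖x k - u‖ ^ 2 - ‖x (k + 1) - u‖ ^ 2)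
    (hc : 0 < c) {K : ℕ} (hK : 0 < K) {θ : ℕ → ℝ} (hθ : ∀ k, θ k = (r ^ (k + 1))⁻¹) :
    F ((∑ j ∈ Finset.range K, θ j)⁻¹ • ∑ k ∈ Finset.range K, θ k • x (k + 1)) - F u
      ≤ ‖x 0 - u‖ ^ 2 / c * r ^ K := by
  have hθpos : ∀ k, 0 < θ k := fun k ↦ by rw [hθ]; positivity
  set S := ∑ j ∈ Finset.range K, θ j with hS
  have hlast : (r ^ K)⁻¹ ≤ S := by
    have := Finset.single_le_sum (f := θ) (s := Finset.range K) (fun i _ ↦ (hθpos i).le)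
      (Finset.mem_range.2 (Nat.sub_lt hK one_pos))
    rwa [hθ, show K - 1 + 1 = K by omega] at this
  have hSpos : 0 < S := lt_of_lt_of_le (by positivity) hlast
  have htel : ∀ N, c * ∑ k ∈ Finset.range N, θ k * (F (x (k + 1)) - F u)
      ≤ ‖x 0 - u‖ ^ 2 - (r ^ N)⁻¹ * ‖x N - u‖ ^ 2 := by
    intro N
    induction N with
    | zero => simp
    | succ N ih =>
      rw [Finset.sum_range_succ]
      have h1 := mul_le_mul_of_nonneg_left (hstep N) (hθpos N).le
      have h2 : θ N * r = (r ^ N)⁻¹ := by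
        rw [hθ, pow_succ]
        field_simp
      rw [← hθ N]
      calc _ = c * ∑ k ∈ Finset.range N, θ k * (F (x (k + 1)) - F u)
            + θ N * (c * (F (x (N + 1)) - F u)) := by ring
        _ ≤ (‖x 0 - u‖ ^ 2 - (θ N * r) * ‖x N - u‖ ^ 2)
            + θ N * (r * ‖x N - u‖ ^ 2 - ‖x (N + 1) - u‖ ^ 2) := by
          rw [h2]; exact add_le_add ih h1
        _ = _ := by ring
  have hjensen : F (S⁻¹ • ∑ k ∈ Finset.range K, θ k • x (k + 1))
      ≤ S⁻¹ * ∑ k ∈ Finset.range K, θ k * F (x (k + 1)) := by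
    have := hF.map_centerMass_le (t := Finset.range K) (w := θ) (p := fun k ↦ x (k + 1))
      (fun i _ ↦ (hθpos i).le) hSpos (fun i _ ↦ Set.mem_univ _)
    simpa [Finset.centerMass] using this
  have hsum : ∑ k ∈ Finset.range K, θ k * (F (x (k + 1)) - F u)
      = ∑ k ∈ Finset.range K, θ k * F (x (k + 1)) - S * F u := by
    simp_rw [mul_sub, Finset.sum_sub_distrib, ← Finset.sum_mul, hS]
  have hbound : c * ∑ k ∈ Finset.range K, θ k * (F (x (k + 1)) - F u) ≤ ‖x 0 - u‖ ^ 2 := by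
    have := htel K
    have h0 : 0 ≤ (r ^ K)⁻¹ * ‖x K - u‖ ^ 2 := by positivity
    linarith
  have hSinv : S⁻¹ ≤ r ^ K := inv_le_of_inv_le₀ (by positivity) hlast
  calc _ ≤ S⁻¹ * ∑ k ∈ Finset.range K, θ k * F (x (k + 1)) - F u := by linarith
    _ = S⁻¹ * ∑ k ∈ Finset.range K, θ k * (F (x (k + 1)) - F u) := by
      rw [hsum]; field_simp
    _ ≤ S⁻¹ * (‖x 0 - u‖ ^ 2 / c) := by
      gcongr
      rw [le_div_iff₀ hc]
      linarith
    _ ≤ ‖x 0 - u‖ ^ 2 / c * r ^ K := by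
      rw [mul_comm]
      gcongr

end ProximalGradient

theorem one_sub_log_pow_le_inv_rpow {a : ℝ} {K : ℕ} (hK : 0 < K)
    (hle : a * Real.log K / K ≤ 1) :
    (1 - a * Real.log K / K) ^ K ≤ ((K : ℝ) ^ a)⁻¹ := by
  have hK' : (0 : ℝ) < K := by exact_mod_cast hK
  have h1 : 1 - a * Real.log K / K ≤ Real.exp (-(a * Real.log K / K)) := by
    linarith [Real.add_one_le_exp (-(a * Real.log K / K))]
  calc _ ≤ Real.exp (-(a * Real.log K / K)) ^ K := by
        gcongr
    _ = _ := by
      rw [← Real.exp_nat_mul, Real.rpow_def_of_pos hK', ← Real.exp_neg]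
      congr 1
      field_simp

theorem stmt_16
    {n : ℕ}
    (f h ωf ωh : EuclideanSpace ℝ (Fin n) → ℝ)
    (f' h' : EuclideanSpace ℝ (Fin n) → EuclideanSpace ℝ (Fin n))
    (Lf Lh μf : ℝ)
    (hμf_pos : 0 < μf) (hμf_le : μf ≤ Lf) (hLh_pos : 0 < Lh)
    (hf_grad : ∀ x, HasGradientAt f (f' x) x)
    (hf_lip : ∀ x y, ‖f' x - f' y‖ ≤ Lf * ‖x - y‖)
    (hf_sc : StrongConvexOn Set.univ μf f)
    (hh_grad : ∀ x, HasGradientAt h (h' x) x)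
    (hh_lip : ∀ x y, ‖h' x - h' y‖ ≤ Lh * ‖x - y‖)
    (hh_conv : ConvexOn ℝ Set.univ h)
    (hωf_conv : ConvexOn ℝ Set.univ ωf)
    (hωh_conv : ConvexOn ℝ Set.univ ωh)
    (fbar hbar : EuclideanSpace ℝ (Fin n) → ℝ)
    (hfbar : ∀ x, fbar x = f x + ωf x)
    (hhbar : ∀ x, hbar x = h x + ωh x)
    (X : Set (EuclideanSpace ℝ (Fin n)))
    (hX : X = {z | ∀ y, hbar z ≤ hbar y})
    (hXne : X.Nonempty)
    (hstar : ℝ)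
    (hhstar : IsGLB (Set.range hbar) hstar)
    (xstar : EuclideanSpace ℝ (Fin n))
    (hxstar_mem : xstar ∈ X)
    (hxstar_min : ∀ y ∈ X, fbar xstar ≤ fbar y)
    (Cf : ℝ)
    (hCf : IsGLB (Set.range fbar) Cf)
    (x : ℕ → EuclideanSpace ℝ (Fin n))
    (η γ : ℝ)
    (hγ_pos : 0 < γ)
    (hx_iter : ∀ k u,
      ωh (x (k+1)) + η * ωf (x (k+1))
        + 1 / (2*γ) * ‖x (k+1) - (x k - γ • (h' (x k) + η • f' (x k)))‖ ^ 2
      ≤ ωh u + η * ωf u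
        + 1 / (2*γ) * ‖u - (x k - γ • (h' (x k) + η • f' (x k)))‖ ^ 2)
    (θ : ℕ → ℝ)
    (hθ : ∀ k : ℕ, θ k = ((1 - η * γ * μf) ^ (k+1))⁻¹)
    (xbar : ℕ → EuclideanSpace ℝ (Fin n))
    (hxbar : ∀ K, xbar K = (∑ j ∈ Finset.range K, θ j)⁻¹ •
        ∑ k ∈ Finset.range K, θ k • x (k+1))
    (p : ℝ) (hp : 0 < p)
    (K : ℕ) (hK : 1 < K)
    (hKcond : 2 * (p + 1) * Lf / μf ≤ (K : ℝ) / Real.log K)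
    (hγ_le2 : γ ≤ 1 / (2 * Lh))
    (hη : η = (p + 1) * Real.log K / (γ * μf * K))
    :
    0 ≤ hbar (xbar K) - hstar
    ∧ hbar (xbar K) - hstar
        ≤ ‖x 0 - xstar‖ ^ 2 / (2 * γ) / (K : ℝ) ^ (p + 1)
          + (p + 1) * (fbar xstar - Cf) / (γ * μf) * Real.log K / K := by
  have hKpos : (0 : ℝ) < K := by exact_mod_cast (zero_lt_one.trans hK)
  have hlog : 0 < Real.log K := Real.log_pos (by exact_mod_cast hK)
  have hLf : 0 < Lf := hμf_pos.trans_le hμf_le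
  have hηpos : 0 < η := by rw [hη]; positivity
  have hq : η * γ * μf = (p + 1) * Real.log K / K := by
    rw [hη]
    field_simp
  have hqL : γ * (η * Lf) ≤ 1 / 2 := by
    rw [div_le_div_iff₀ hμf_pos hlog] at hKcond
    have : γ * (η * Lf) = (p + 1) * Real.log K * Lf / (μf * K) := by
      rw [hη]
      field_simp
    rw [this, div_le_div_iff₀ (by positivity) two_pos]
    linarith
  have hγL : γ * Lh ≤ 1 / 2 := by
    rw [le_div_iff₀ (by positivity)] at hγ_le2
    linarith
  have hq_half : η * γ * μf ≤ 1 / 2 := by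
    have : γ * (η * μf) ≤ γ * (η * Lf) := by gcongr
    linarith
  have hω : ConvexOn ℝ Set.univ fun u ↦ ωh u + η * ωf u :=
    hωh_conv.add (hωf_conv.smul hηpos.le)
  have hh0 : StrongConvexOn Set.univ 0 h := strongConvexOn_zero.2 hh_conv
  have hstep : ∀ k, 2 * γ * ((hbar (x (k + 1)) + η * fbar (x (k + 1)))
        - (hbar xstar + η * fbar xstar))
      ≤ (1 - η * γ * μf) * ‖x k - xstar‖ ^ 2 - ‖x (k + 1) - xstar‖ ^ 2 := by
    intro k
    have key := proximal_gradient_step (g := fun u ↦ h u + η * f u) hω (m := η * μf) hγ_pos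
      (u := xstar) (hx_iter k) ?_ ?_
    · simp only [hfbar, hhbar]
      linarith
    · have h1 := descent_of_lipschitz_gradient hh_grad hh_lip (x k) (x (k + 1))
      have h2 := mul_le_mul_of_nonneg_left
        (descent_of_lipschitz_gradient hf_grad hf_lip (x k) (x (k + 1))) hηpos.le
      have h3 : (Lh + η * Lf) / 2 ≤ 1 / (2 * γ) := by
        rw [div_le_div_iff₀ two_pos (by positivity)]
        linarith
      have h4 := mul_le_mul_of_nonneg_right h3 (sq_nonneg ‖x (k + 1) - x k‖)
      rw [inner_add_left, real_inner_smul_left]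
      linarith
    · have h1 := hh0.add_inner_gradient_le (hh_grad (x k)) xstar
      have h2 := mul_le_mul_of_nonneg_left
        (hf_sc.add_inner_gradient_le (hf_grad (x k)) xstar) hηpos.le
      rw [inner_add_left, real_inner_smul_left]
      linarith
  have hF : ConvexOn ℝ Set.univ fun u ↦ hbar u + η * fbar u := by
    have hf_conv : ConvexOn ℝ Set.univ f :=
      strongConvexOn_zero.1 (StrongConvexOn.mono hμf_pos.le hf_sc)
    rw [funext hfbar, funext hhbar]
    exact (hh_conv.add hωh_conv).add ((hf_conv.add hωf_conv).smul hηpos.le)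
  have hbound := hF.geometric_average_le (by linarith) hstep (by positivity)
    (zero_lt_one.trans hK) hθ
  rw [← hxbar] at hbound
  have hrate : (1 - η * γ * μf) ^ K ≤ ((K : ℝ) ^ (p + 1))⁻¹ := by
    rw [hq] at hq_half ⊢
    exact one_sub_log_pow_le_inv_rpow (zero_lt_one.trans hK) (by linarith)
  have hstar_eq : hbar xstar = hstar := by
    rw [hX] at hxstar_mem
    exact le_antisymm (hhstar.2 (by rintro _ ⟨y, rfl⟩; exact hxstar_mem y)) (hhstar.1 ⟨_, rfl⟩)
  refine ⟨sub_nonneg.2 (hhstar.1 ⟨_, rfl⟩), ?_⟩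
  have hCf_le := mul_le_mul_of_nonneg_left (hCf.1 ⟨xbar K, rfl⟩) hηpos.le
  have hfirst := mul_le_mul_of_nonneg_left hrate
    (by positivity : 0 ≤ ‖x 0 - xstar‖ ^ 2 / (2 * γ))
  rw [← div_eq_mul_inv] at hfirst
  have hlast : (p + 1) * (fbar xstar - Cf) / (γ * μf) * Real.log K / K
      = η * (fbar xstar - Cf) := by
    rw [hη]
    field_simp
  rw [hlast]
  linarith
end
end

section
/- Let (x_k) be the R-VFISTA iterates with constant regularization parameter η > 0. Suppose X*_h̄ is an α-weak sharp minima of order m = 1 and η ≤ α/(2‖∇̃f̄(x*)‖). Set u_{11} := f̄(x_0) − f̄* + (h̄(x_0) − h̄*)/η + (μ_f/2)‖x_0 − x*‖² and ρ := 1 − 1/√κ_η. Then for every K ≥ 1: (a) 0 ≤ h̄(x_K) − h̄* ≤ 2η·u_{11}·ρ^K; (b) dist(x_K, X*_h̄) ≤ (2η·u_{11}/α)·ρ^K; (c) −u_{11}·ρ^K ≤ f̄(x_K) − f̄* ≤ u_{11}·ρ^K; (d) ‖x_K − x*‖² ≤ (4u_{11}/μ_f)·ρ^K. -/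
open scoped RealInnerProductSpace
open Metric Filter

noncomputable section

section Convexity

variable {E : Type*} [NormedAddCommGroup E] [InnerProductSpace ℝ E]

lemma StrongConvexOn.const_mul {f : E → ℝ} {s : Set E} {m c : ℝ} (hf : StrongConvexOn s m f)
    (hc : 0 ≤ c) : StrongConvexOn s (c * m) (fun x => c * f x) := by
  refine ⟨hf.1, fun x hx y hy a b ha hb hab => ?_⟩
  have := mul_le_mul_of_nonneg_left (hf.2 hx hy ha hb hab) hc
  simp only [smul_eq_mul] at this ⊢
  linarith

lemma StrongConvexOn.add_convexOn {f g : E → ℝ} {s : Set E} {m : ℝ} (hf : StrongConvexOn s m f)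
    (hg : ConvexOn ℝ s g) : StrongConvexOn s m (fun x => f x + g x) := by
  refine ⟨hf.1, fun x hx y hy a b ha hb hab => ?_⟩
  have h₁ := hf.2 hx hy ha hb hab
  have h₂ := hg.2 hx hy ha hb hab
  simp only [smul_eq_mul] at h₁ h₂ ⊢
  linarith

/-- A subgradient of a strongly convex function yields a quadratic lower bound. -/
lemma StrongConvexOn.add_sq_le_of_subgradient {F : E → ℝ} {m : ℝ}
    (hF : StrongConvexOn Set.univ m F) {x g : E} (hg : ∀ y, F x + ⟪g, y - x⟫ ≤ F y) (y : E) :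
    F x + ⟪g, y - x⟫ + m / 2 * ‖y - x‖ ^ 2 ≤ F y := by
  have key : ∀ t ∈ Set.Ioo (0 : ℝ) 1,
      F x + ⟪g, y - x⟫ + (1 - t) * (m / 2 * ‖y - x‖ ^ 2) ≤ F y := by
    rintro t ⟨ht₀, ht₁⟩
    have h₁ := hF.2 (Set.mem_univ y) (Set.mem_univ x) ht₀.le (sub_nonneg.2 ht₁.le)
      (add_sub_cancel t 1)
    have h₂ := hg (t • y + (1 - t) • x)
    rw [show t • y + (1 - t) • x - x = t • (y - x) by module, inner_smul_right] at h₂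
    simp only [smul_eq_mul] at h₁
    refine le_of_mul_le_mul_left ?_ ht₀
    linarith
  have hlim : Tendsto (fun t : ℝ => F x + ⟪g, y - x⟫ + (1 - t) * (m / 2 * ‖y - x‖ ^ 2))
      (nhdsWithin 0 (Set.Ioi 0)) (nhds (F x + ⟪g, y - x⟫ + (1 - 0) * (m / 2 * ‖y - x‖ ^ 2))) :=
    Continuous.tendsto' (by fun_prop) _ _ rfl |>.mono_left nhdsWithin_le_nhds
  rw [sub_zero, one_mul] at hlim
  exact le_of_tendsto hlim (Filter.mem_of_superset (Ioo_mem_nhdsGT one_pos) key)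

/-- The optimality condition of a proximal step, in three-point form. -/
lemma ConvexOn.prox_three_point {ω : E → ℝ} (hω : ConvexOn ℝ Set.univ ω) {L : ℝ} {p z : E}
    (hz : ∀ u, ω z + L / 2 * ‖z - p‖ ^ 2 ≤ ω u + L / 2 * ‖u - p‖ ^ 2) (u : E) :
    ω z + L / 2 * ‖z - p‖ ^ 2 + L / 2 * ‖u - z‖ ^ 2 ≤ ω u + L / 2 * ‖u - p‖ ^ 2 := by
  have hF : StrongConvexOn Set.univ L (fun u => ω u + L / 2 * ‖u - p‖ ^ 2) := by
    refine ⟨convex_univ, fun x _ y _ a b ha hb hab => ?_⟩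
    have h₁ := hω.2 (Set.mem_univ x) (Set.mem_univ y) ha hb hab
    have h₂ : ‖a • x + b • y - p‖ ^ 2
        = a * ‖x - p‖ ^ 2 + b * ‖y - p‖ ^ 2 - a * b * ‖x - y‖ ^ 2 := by
      rw [show a • x + b • y - p = a • (x - p) + b • (y - p) by
          rw [← eq_sub_iff_add_eq'] at hab; subst hab; module,
        show x - y = (x - p) - (y - p) by abel]
      simp only [norm_add_sq_real, norm_sub_sq_real (x - p), norm_smul, inner_smul_left,
        inner_smul_right, mul_pow, Real.norm_eq_abs, sq_abs, RCLike.conj_to_real]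
      obtain rfl : b = 1 - a := by linarith
      ring
    simp only [smul_eq_mul] at h₁ ⊢
    rw [h₂]
    linarith
  simpa using hF.add_sq_le_of_subgradient (x := z) (g := 0) (by simpa using hz) u

end Convexity

section Gradient

variable {E : Type*} [NormedAddCommGroup E] [InnerProductSpace ℝ E] [CompleteSpace E]

lemma HasGradientAt.hasDerivAt_comp_add_smul {f : E → ℝ} {f' x d : E} {t : ℝ}
    (hf : HasGradientAt f f' (x + t • d)) :
    HasDerivAt (fun s : ℝ => f (x + s • d)) ⟪f', d⟫ t := by
  have hline : HasDerivAt (fun s : ℝ => x + s • d) d t := by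
    simpa using ((hasDerivAt_id t).smul_const d).const_add x
  have h := hf.hasFDerivAt.comp_hasDerivAt t hline
  rwa [InnerProductSpace.toDual_apply_apply] at h

lemma ConvexOn.add_inner_gradient_le {f : E → ℝ} (hf : ConvexOn ℝ Set.univ f) {x f' : E}
    (hx : HasGradientAt f f' x) (y : E) : f x + ⟪f', y - x⟫ ≤ f y := by
  have hconv : ConvexOn ℝ Set.univ (fun s : ℝ => f (x + s • (y - x))) := by
    refine ⟨convex_univ, fun s _ t _ a b ha hb hab => ?_⟩
    have := hf.2 (Set.mem_univ (x + s • (y - x))) (Set.mem_univ (x + t • (y - x))) ha hb hab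
    convert this using 2
    rw [← eq_sub_iff_add_eq'] at hab; subst hab; simp only [smul_eq_mul]; module
  have hder : HasDerivAt (fun s : ℝ => f (x + s • (y - x))) ⟪f', y - x⟫ 0 :=
    HasGradientAt.hasDerivAt_comp_add_smul (by simpa using hx)
  have := hconv.le_slope_of_hasDerivAt (Set.mem_univ 0) (Set.mem_univ 1) one_pos hder
  simp [slope] at this
  linarith

/-- The descent lemma for functions with Lipschitz gradient. -/
lemma le_add_inner_add_sq_of_gradient_lipschitz {f : E → ℝ} {f' : E → E} {L : ℝ}
    (hf : ∀ x, HasGradientAt f (f' x) x) (hL : ∀ x y, ‖f' x - f' y‖ ≤ L * ‖x - y‖) (x y : E) :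
    f y ≤ f x + ⟪f' x, y - x⟫ + L / 2 * ‖y - x‖ ^ 2 := by
  set d := y - x with hd
  have hder : ∀ t : ℝ, HasDerivAt
      (fun s : ℝ => f (x + s • d) - (s * ⟪f' x, d⟫ + s ^ 2 * (L / 2 * ‖d‖ ^ 2)))
      (⟪f' (x + t • d), d⟫ - (⟪f' x, d⟫ + 2 * t * (L / 2 * ‖d‖ ^ 2))) t := fun t => by
    refine (hf _).hasDerivAt_comp_add_smul.sub (HasDerivAt.add ?_ ?_)
    · simpa using (hasDerivAt_id t).mul_const ⟪f' x, d⟫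
    · simpa using (hasDerivAt_pow 2 t).mul_const (L / 2 * ‖d‖ ^ 2)
  have hanti := antitoneOn_of_hasDerivWithinAt_nonpos (convex_Icc (0 : ℝ) 1)
    (fun t _ => (hder t).continuousAt.continuousWithinAt)
    (fun t _ => (hder t).hasDerivWithinAt) (fun t ht => by
      rw [interior_Icc] at ht
      have h₁ := real_inner_le_norm (f' (x + t • d) - f' x) d
      have h₂ := mul_le_mul_of_nonneg_right (hL (x + t • d) x) (norm_nonneg d)
      rw [add_sub_cancel_left, norm_smul, Real.norm_of_nonneg ht.1.le] at h₂
      rw [inner_sub_left] at h₁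
      linarith)
  have := hanti (Set.left_mem_Icc.2 zero_le_one) (Set.right_mem_Icc.2 zero_le_one) zero_le_one
  simp only [hd, one_smul, zero_smul, add_zero, add_sub_cancel] at this
  linarith

end Gradient

section Acceleration

variable {E : Type*} [NormedAddCommGroup E] [InnerProductSpace ℝ E]

/-- One step of the forward-backward method with step size `1 / L`, compared with any point `w`. -/
lemma forward_backward_step {φ ω : E → ℝ} (hω : ConvexOn ℝ Set.univ ω) {L m : ℝ} (hL : 0 < L)
    {G y z : E}
    (hup : φ z ≤ φ y + ⟪G, z - y⟫ + L / 2 * ‖z - y‖ ^ 2)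
    (hlow : ∀ w, φ y + ⟪G, w - y⟫ + m / 2 * ‖w - y‖ ^ 2 ≤ φ w)
    (hz : ∀ u, ω z + L / 2 * ‖z - (y - (1 / L) • G)‖ ^ 2
      ≤ ω u + L / 2 * ‖u - (y - (1 / L) • G)‖ ^ 2) (w : E) :
    φ z + ω z + L / 2 * ‖w - z‖ ^ 2 ≤ φ w + ω w + (L - m) / 2 * ‖w - y‖ ^ 2 := by
  have hexp : ∀ u, L / 2 * ‖u - (y - (1 / L) • G)‖ ^ 2
      = L / 2 * ‖u - y‖ ^ 2 + ⟪G, u - y⟫ + L / 2 * ‖(1 / L) • G‖ ^ 2 := fun u => by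
    rw [← sub_add, norm_add_sq_real, inner_smul_right, real_inner_comm]
    field_simp
  have h := hω.prox_three_point hz w
  rw [hexp, hexp] at h
  linarith [hlow w]

/-- Contraction of the Lyapunov function of the accelerated method along one step. Here `v` is the
auxiliary point with `(1 + θ) • (y - x) = θ • (v - x)`. -/
lemma accelerated_step {F : E → ℝ} {L m θ : ℝ} (hF : StrongConvexOn Set.univ m F)
    (hm : 0 ≤ m) (hθ₀ : 0 < θ) (hθ₁ : θ ≤ 1) (hLθ : L * θ ^ 2 = m) {x y v x₁ : E}
    (hv : (1 + θ) • (y - x) = θ • (v - x))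
    (hstep : ∀ w, F x₁ + L / 2 * ‖w - x₁‖ ^ 2 ≤ F w + (L - m) / 2 * ‖w - y‖ ^ 2) (z : E) :
    F x₁ - F z + m / 2 * ‖x + (1 / θ) • (x₁ - x) - z‖ ^ 2
      ≤ (1 - θ) * (F x - F z + m / 2 * ‖v - z‖ ^ 2) := by
  have hw := hstep (θ • z + (1 - θ) • x)
  have hconv := hF.2 (Set.mem_univ z) (Set.mem_univ x) hθ₀.le (sub_nonneg.2 hθ₁)
    (add_sub_cancel θ 1)
  simp only [smul_eq_mul] at hconv
  have hθ' : (1 + θ) ≠ 0 := by positivity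
  have h₁ : L / 2 * ‖θ • z + (1 - θ) • x - x₁‖ ^ 2
      = m / 2 * ‖x + (1 / θ) • (x₁ - x) - z‖ ^ 2 := by
    rw [show θ • z + (1 - θ) • x - x₁ = (-θ) • (x + (1 / θ) • (x₁ - x) - z) by
      match_scalars <;> field_simp
      ring]
    rw [norm_smul, mul_pow, Real.norm_eq_abs, sq_abs, ← hLθ]
    ring
  have hy : y - x = (θ / (1 + θ)) • (v - x) := by
    rw [div_eq_inv_mul, mul_smul, ← hv, inv_smul_smul₀ hθ']
  have h₂ : ‖θ • z + (1 - θ) • x - y‖ ^ 2 = θ ^ 2 * (‖z - x‖ ^ 2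
      - 2 / (1 + θ) * ⟪z - x, v - x⟫ + 1 / (1 + θ) ^ 2 * ‖v - x‖ ^ 2) := by
    rw [show θ • z + (1 - θ) • x - y = θ • (z - x) - (y - x) by module, hy, norm_sub_sq_real]
    simp only [norm_smul, inner_smul_left, inner_smul_right, mul_pow, Real.norm_eq_abs, sq_abs,
      RCLike.conj_to_real]
    field_simp
  have h₃ : ‖v - z‖ ^ 2 = ‖v - x‖ ^ 2 - 2 * ⟪z - x, v - x⟫ + ‖z - x‖ ^ 2 := by
    rw [show v - z = (v - x) - (z - x) by abel, norm_sub_sq_real, real_inner_comm]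
  have h₄ : (L - m) / 2 * ‖θ • z + (1 - θ) • x - y‖ ^ 2
      - θ * (1 - θ) * (m / 2 * ‖z - x‖ ^ 2)
      = (1 - θ) * (m / 2 * ‖v - z‖ ^ 2) - (1 - θ) * (m / 2 * (θ / (1 + θ) * ‖v - x‖ ^ 2)) := by
    rw [h₂, h₃, ← hLθ]
    field_simp
    ring
  have h₅ : 0 ≤ (1 - θ) * (m / 2 * (θ / (1 + θ) * ‖v - x‖ ^ 2)) :=
    mul_nonneg (sub_nonneg.2 hθ₁) (by positivity)
  linarith

/-- Linear convergence of the accelerated method for strongly convex functions, relative to an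
arbitrary comparison point `z`. -/
lemma accelerated_method_rate {F : E → ℝ} {L m θ : ℝ} (hF : StrongConvexOn Set.univ m F)
    (hm : 0 ≤ m) (hθ₀ : 0 < θ) (hθ₁ : θ ≤ 1) (hLθ : L * θ ^ 2 = m) {x y : ℕ → E}
    (hy₀ : y 0 = x 0)
    (hy : ∀ k, y (k + 1) = x (k + 1) + ((1 - θ) / (1 + θ)) • (x (k + 1) - x k))
    (hstep : ∀ k w, F (x (k + 1)) + L / 2 * ‖w - x (k + 1)‖ ^ 2
      ≤ F w + (L - m) / 2 * ‖w - y k‖ ^ 2) (z : E) (K : ℕ) :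
    F (x K) - F z ≤ (F (x 0) - F z + m / 2 * ‖x 0 - z‖ ^ 2) * (1 - θ) ^ K := by
  have key : ∃ v, (1 + θ) • (y K - x K) = θ • (v - x K) ∧
      F (x K) - F z + m / 2 * ‖v - z‖ ^ 2
        ≤ (F (x 0) - F z + m / 2 * ‖x 0 - z‖ ^ 2) * (1 - θ) ^ K := by
    induction K with
    | zero => exact ⟨x 0, by simp [hy₀], by simp⟩
    | succ K ih =>
      obtain ⟨v, hv, hle⟩ := ih
      refine ⟨x K + (1 / θ) • (x (K + 1) - x K), ?_, ?_⟩
      · have hθ' : (1 + θ) ≠ 0 := by positivity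
        rw [hy, add_sub_cancel_left, smul_smul]
        match_scalars <;> field_simp
        ring
      · refine (accelerated_step hF hm hθ₀ hθ₁ hLθ hv (hstep K) z).trans ?_
        rw [pow_succ (1 - θ), ← mul_assoc]
        linarith [mul_le_mul_of_nonneg_left hle (sub_nonneg.2 hθ₁)]
  obtain ⟨v, -, hle⟩ := key
  linarith [show 0 ≤ m / 2 * ‖v - z‖ ^ 2 by positivity]

/-- A vector making nonnegative inner products with `X - x₀` decreases at most at rate `‖g‖`
away from `X`. -/
lemma neg_norm_mul_infDist_le_inner {X : Set E} (hX : X.Nonempty) {g x₀ : E}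
    (hg : ∀ y ∈ X, 0 ≤ ⟪g, y - x₀⟫) (x : E) : -(‖g‖ * infDist x X) ≤ ⟪g, x - x₀⟫ := by
  rcases eq_or_ne g 0 with rfl | hg₀
  · simp
  have hpos : 0 < ‖g‖ := norm_pos_iff.2 hg₀
  have : -⟪g, x - x₀⟫ / ‖g‖ ≤ infDist x X := by
    refine (le_infDist hX).2 fun y hy => ?_
    rw [div_le_iff₀ hpos, dist_eq_norm, norm_sub_rev]
    have h₁ := real_inner_le_norm g (y - x)
    have h₂ := hg y hy
    rw [show y - x₀ = (y - x) + (x - x₀) by abel, inner_add_right] at h₂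
    linarith
  rw [div_le_iff₀ hpos] at this
  linarith

end Acceleration

theorem stmt_19
    {n : ℕ}
    (f h ωf ωh : EuclideanSpace ℝ (Fin n) → ℝ)
    (f' h' : EuclideanSpace ℝ (Fin n) → EuclideanSpace ℝ (Fin n))
    (Lf Lh μf : ℝ)
    (hμf_pos : 0 < μf) (hμf_le : μf ≤ Lf) (hLh_pos : 0 < Lh)
    (hf_grad : ∀ x, HasGradientAt f (f' x) x)
    (hf_lip : ∀ x y, ‖f' x - f' y‖ ≤ Lf * ‖x - y‖)
    (hf_sc : StrongConvexOn Set.univ μf f)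
    (hh_grad : ∀ x, HasGradientAt h (h' x) x)
    (hh_lip : ∀ x y, ‖h' x - h' y‖ ≤ Lh * ‖x - y‖)
    (hh_conv : ConvexOn ℝ Set.univ h)
    (hωf_conv : ConvexOn ℝ Set.univ ωf)
    (hωh_conv : ConvexOn ℝ Set.univ ωh)
    (fbar hbar : EuclideanSpace ℝ (Fin n) → ℝ)
    (hfbar : ∀ x, fbar x = f x + ωf x)
    (hhbar : ∀ x, hbar x = h x + ωh x)
    (X : Set (EuclideanSpace ℝ (Fin n)))
    (hX : X = {z | ∀ y, hbar z ≤ hbar y})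
    (hXne : X.Nonempty)
    (hstar : ℝ)
    (hhstar : IsGLB (Set.range hbar) hstar)
    (xstar : EuclideanSpace ℝ (Fin n))
    (hxstar_mem : xstar ∈ X)
    (hxstar_min : ∀ y ∈ X, fbar xstar ≤ fbar y)
    (g : EuclideanSpace ℝ (Fin n))
    (hg_sub : ∀ y, fbar xstar + ⟪g, y - xstar⟫ ≤ fbar y)
    (hg_opt : ∀ y ∈ X, (0:ℝ) ≤ ⟪g, y - xstar⟫)
    (η : ℝ) (hη_pos : 0 < η)
    (x y : ℕ → EuclideanSpace ℝ (Fin n))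
    (κ γ : ℝ)
    (hκ : κ = (Lh + η * Lf) / (η * μf))
    (hγ : γ = 1 / (Lh + η * Lf))
    (hy0 : y 0 = x 0)
    (hx_iter : ∀ k u,
      ωh (x (k+1)) + η * ωf (x (k+1))
        + 1 / (2*γ) * ‖x (k+1) - (y k - γ • (h' (y k) + η • f' (y k)))‖ ^ 2
      ≤ ωh u + η * ωf u
        + 1 / (2*γ) * ‖u - (y k - γ • (h' (y k) + η • f' (y k)))‖ ^ 2)
    (hy_iter : ∀ k, y (k+1) = x (k+1)
        + ((Real.sqrt κ - 1) / (Real.sqrt κ + 1)) • (x (k+1) - x k))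
    (α : ℝ) (hα : 0 < α)
    (hws : ∀ z, α * Metric.infDist z X ≤ hbar z - hstar)
    (hg_ne : g ≠ 0)
    (hηα : η ≤ α / (2 * ‖g‖))
    (u11 ρ : ℝ)
    (hu11 : u11 = fbar (x 0) - fbar xstar + (hbar (x 0) - hstar) / η
        + μf / 2 * ‖x 0 - xstar‖ ^ 2)
    (hρ : ρ = 1 - 1 / Real.sqrt κ) :
    ∀ K : ℕ, 1 ≤ K →
      (0 ≤ hbar (x K) - hstar ∧ hbar (x K) - hstar ≤ 2 * η * u11 * ρ ^ K)
      ∧ Metric.infDist (x K) X ≤ 2 * η * u11 / α * ρ ^ K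
      ∧ (-u11 * ρ ^ K ≤ fbar (x K) - fbar xstar
          ∧ fbar (x K) - fbar xstar ≤ u11 * ρ ^ K)
      ∧ ‖x K - xstar‖ ^ 2 ≤ 4 * u11 / μf * ρ ^ K := by
  intro K _
  have hLf_pos : 0 < Lf := hμf_pos.trans_le hμf_le
  set L := Lh + η * Lf with hLdef
  have hL : 0 < L := by positivity
  have hm : 0 < η * μf := by positivity
  have hκ1 : 1 ≤ κ := by
    rw [hκ, le_div_iff₀ hm]
    linarith [mul_le_mul_of_nonneg_left hμf_le hη_pos.le]
  have hκ0 : 0 < κ := one_pos.trans_le hκ1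
  have hs1 : 1 ≤ √κ := Real.one_le_sqrt.2 hκ1
  have hs0 : 0 < √κ := one_pos.trans_le hs1
  have hθ1 : 1 / √κ ≤ 1 := (div_le_one hs0).2 hs1
  have hLθ : L * (1 / √κ) ^ 2 = η * μf := by
    rw [div_pow, Real.sq_sqrt hκ0.le, hκ]
    field_simp
  have hγL : 1 / (2 * γ) = L / 2 := by rw [hγ]; field_simp
  have hω : ConvexOn ℝ Set.univ (fun u => ωh u + η * ωf u) :=
    hωh_conv.add (hωf_conv.smul hη_pos.le)
  have hF : StrongConvexOn Set.univ (η * μf) (fun u => h u + η * f u + (ωh u + η * ωf u)) := by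
    simpa only [add_comm (h _)] using
      ((hf_sc.const_mul hη_pos.le).add_convexOn hh_conv).add_convexOn hω
  have hf_conv : ConvexOn ℝ Set.univ f := strongConvexOn_zero.1 (hf_sc.mono hμf_pos.le)
  have hrate := accelerated_method_rate hF hm.le (by positivity) hθ1 hLθ hy0
    (fun k => by
      rw [hy_iter k]
      congr 2
      field_simp)
    (fun k => forward_backward_step (φ := fun u => h u + η * f u) (G := h' (y k) + η • f' (y k))
      (y := y k) (z := x (k + 1)) hω hL
      (by
        have h₁ := le_add_inner_add_sq_of_gradient_lipschitz hh_grad hh_lip (y k) (x (k + 1))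
        have h₂ := mul_le_mul_of_nonneg_left (le_add_inner_add_sq_of_gradient_lipschitz hf_grad
          hf_lip (y k) (x (k + 1))) hη_pos.le
        simp only [inner_add_left, inner_smul_left, RCLike.conj_to_real, hLdef]
        linarith)
      (fun w => by
        have h₁ := hh_conv.add_inner_gradient_le (hh_grad (y k)) w
        have h₂ := mul_le_mul_of_nonneg_left (hf_sc.add_sq_le_of_subgradient
          (hf_conv.add_inner_gradient_le (hf_grad (y k))) w) hη_pos.le
        simp only [inner_add_left, inner_smul_left, RCLike.conj_to_real]
        linarith)
      (fun u => by
        have := hx_iter k u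
        rwa [hγL, hγ] at this))
    xstar K
  rw [← hρ] at hrate
  have hstar_eq : hbar xstar = hstar := by
    rw [hX] at hxstar_mem
    have hleast : IsLeast (Set.range hbar) (hbar xstar) :=
      ⟨⟨xstar, rfl⟩, Set.forall_mem_range.2 hxstar_mem⟩
    exact hleast.isGLB.unique hhstar
  have hsum : hbar (x K) - hstar + η * (fbar (x K) - fbar xstar) ≤ η * (u11 * ρ ^ K) := by
    have hu : η * u11 = h (x 0) + η * f (x 0) + (ωh (x 0) + η * ωf (x 0))
        - (h xstar + η * f xstar + (ωh xstar + η * ωf xstar))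
        + η * μf / 2 * ‖x 0 - xstar‖ ^ 2 := by
      rw [hu11, ← hstar_eq, hfbar, hfbar, hhbar, hhbar]
      field_simp
      ring
    rw [← mul_assoc, hu, ← hstar_eq, hfbar, hfbar, hhbar, hhbar]
    linarith
  set B := u11 * ρ ^ K with hB
  have hg_pos : 0 < ‖g‖ := norm_pos_iff.2 hg_ne
  have hη2 : 2 * (η * ‖g‖) ≤ α := by
    rw [le_div_iff₀ (by positivity)] at hηα
    linarith
  have hd := infDist_nonneg (x := x K) (s := X)
  have hwsK := hws (x K)
  have hinner := neg_norm_mul_infDist_le_inner hXne hg_opt (x K)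
  have hfsub := hg_sub (x K)
  have hηd : 2 * (η * (‖g‖ * infDist (x K) X)) ≤ α * infDist (x K) X := by
    linarith [mul_le_mul_of_nonneg_right hη2 hd]
  have hfl : -(η * (‖g‖ * infDist (x K) X)) ≤ η * (fbar (x K) - fbar xstar) := by
    have : -(‖g‖ * infDist (x K) X) ≤ fbar (x K) - fbar xstar := by linarith
    linarith [mul_le_mul_of_nonneg_left this hη_pos.le]
  have hh0 : 0 ≤ hbar (x K) - hstar := sub_nonneg.2 (hhstar.1 ⟨x K, rfl⟩)
  have ha : hbar (x K) - hstar ≤ 2 * (η * B) := by linarith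
  have hgd : ‖g‖ * infDist (x K) X ≤ B := le_of_mul_le_mul_left (by linarith) hη_pos
  have hup : fbar (x K) - fbar xstar ≤ B := le_of_mul_le_mul_left (by linarith) hη_pos
  have hfbar_sc : StrongConvexOn Set.univ μf fbar := by
    rw [funext hfbar]
    exact hf_sc.add_convexOn hωf_conv
  have hquad := hfbar_sc.add_sq_le_of_subgradient hg_sub (x K)
  refine ⟨⟨hh0, by linarith⟩, ?_, ⟨by linarith, hup⟩, ?_⟩
  · rw [div_mul_eq_mul_div, le_div_iff₀ hα]
    linarith
  · rw [div_mul_eq_mul_div, le_div_iff₀ hμf_pos]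
    linarith
end
end
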